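/- Let 1 < q < p < ∞ and 0 < s < 1. Suppose a closed set E ⊂ X satisfies the upper Aikawa condition with exponent α = sq. Let z ∈ E, let r > 0 satisfy 0 < r < diam(E) if diam(E) > 0 or 0 < r < diam(X) if diam(E) = 0, and let F be the truncated set obtained from E, z, r by the truncation construction. Then there exists a constant C > 0, independent of z and r, such that for every Lipschitz function u : X → ℝ with u = 0 on F one has ∫_{B(z,8r)\F} |u(x)|^p dist(x,F)^{−sp} dμ(x) ≤ C ∫_{B(z,8r)} ∫_{B(z,8r)} |u(x)−u(y)|^p / (d(x,y)^{sp} μ(B(x,d(x,y)))) dμ(y) dμ(x). -/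

import Mathlib

open Metric MeasureTheory Set
open scoped ENNReal NNReal

/-- The effective diameter bound: `diam E`, unless `diam E = 0`, in which case `diam X`. -/
noncomputable def diamBound {X : Type*} [PseudoEMetricSpace X] (E : Set X) : ℝ≥0∞ :=
  haveI := Classical.propDecidable
  if EMetric.diam E = 0 then EMetric.diam (Set.univ : Set X) else EMetric.diam E

/-- `E` satisfies the upper Aikawa condition with exponent `α`. -/
def upperAikawaCond {X : Type*} [MetricSpace X] [MeasurableSpace X]
    (μ : Measure X) (E : Set X) (α : ℝ) : Prop :=
  ∀ ε : ℝ, 0 < ε → ∃ δ : ℝ, 0 < δ ∧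
    ∀ z ∈ E, ∀ R : ℝ, 0 < R → ENNReal.ofReal R < diamBound E →
      ∀ K : Set X, MeasurableSet K →
        μ (ball z R \ K) ≤ ENNReal.ofReal δ * μ (ball z R) →
        ENNReal.ofReal (R ^ (-α) / ε) ≤
          (μ (ball z R))⁻¹ *
            ∫⁻ y in ball z R ∩ K, ENNReal.ofReal (infDist y E ^ (-α)) ∂μ

/-- The truncation sequence: `F₀ = E ∩ closedBall z (r/2)` and recursively
`F_{j+1} = ⋃_{x ∈ F_j} E ∩ closedBall x (r / 2^(j+2))`. -/
def truncSeq {X : Type*} [MetricSpace X] (E : Set X) (z : X) (r : ℝ) : ℕ → Set X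
  | 0 => E ∩ closedBall z (r / 2)
  | j + 1 => ⋃ x ∈ truncSeq E z r j, E ∩ closedBall x (r / 2 ^ (j + 2))

/-- The truncated set `F`, the closure of the union of the truncation sequence. -/
def truncSet {X : Type*} [MetricSpace X] (E : Set X) (z : X) (r : ℝ) : Set X :=
  closure (⋃ j : ℕ, truncSeq E z r j)

/-- The fractional `(s,p)`-Gagliardo kernel `|u x - u y|^p / (d(x,y)^{sp} μ(B(x,d(x,y))))`. -/
noncomputable def fracKernel {X : Type*} [MetricSpace X] [MeasurableSpace X]
    (μ : Measure X) (s p : ℝ) (u : X → ℝ) (x y : X) : ℝ≥0∞ :=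
  ENNReal.ofReal (|u x - u y| ^ p) /
    (ENNReal.ofReal (dist x y ^ (s * p)) * μ (ball x (dist x y)))

section Truncation

variable {X : Type*} [MetricSpace X] {E : Set X} {z : X} {r : ℝ}

lemma truncSeq_subset (j : ℕ) : truncSeq E z r j ⊆ E := by
  cases j with
  | zero => exact inter_subset_left
  | succ j => exact iUnion₂_subset fun _ _ => inter_subset_left

lemma truncSet_subset (hE : IsClosed E) : truncSet E z r ⊆ E :=
  closure_minimal (iUnion_subset truncSeq_subset) hE

lemma truncSeq_subset_truncSet (j : ℕ) : truncSeq E z r j ⊆ truncSet E z r :=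
  (subset_iUnion _ j).trans subset_closure

lemma center_mem_truncSet (hz : z ∈ E) (hr : 0 < r) : z ∈ truncSet E z r :=
  truncSeq_subset_truncSet 0 ⟨hz, mem_closedBall_self (by positivity)⟩

lemma exists_ancestor_truncSeq {i j : ℕ} (hij : i ≤ j) {e : X} (he : e ∈ truncSeq E z r j) :
    ∃ e' ∈ truncSeq E z r i, dist e e' ≤ r / 2 ^ (i + 1) - r / 2 ^ (j + 1) := by
  induction j, hij using Nat.le_induction generalizing e with
  | base => exact ⟨e, he, by simp⟩
  | succ j _ ih =>
    simp only [truncSeq, mem_iUnion, exists_prop] at he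
    obtain ⟨f, hf, -, hef⟩ := he
    obtain ⟨e', he', hd⟩ := ih hf
    refine ⟨e', he', (dist_triangle e f e').trans ?_⟩
    have h : r / 2 ^ (j + 1) = 2 * (r / 2 ^ (j + 2)) := by
      rw [pow_succ _ (j + 1)]; field_simp
    have h2 : j + 1 + 1 = j + 2 := rfl
    rw [mem_closedBall] at hef
    rw [h2]
    linarith

lemma truncSeq_subset_closedBall (hr : 0 < r) (j : ℕ) :
    truncSeq E z r j ⊆ closedBall z r := by
  intro e he
  obtain ⟨e', he', hd⟩ := exists_ancestor_truncSeq (Nat.zero_le j) he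
  have h1 : dist e' z ≤ r / 2 := he'.2
  have h2 : 0 < r / 2 ^ (j + 1) := by positivity
  have h3 := dist_triangle e e' z
  rw [mem_closedBall]
  norm_num at hd
  linarith

lemma exists_near_inter_closedBall_subset_truncSet {j : ℕ} {e : X} (he : e ∈ truncSeq E z r j)
    {R : ℝ} (hR : 0 < R) (hRr : R ≤ r) :
    ∃ i, ∃ e' ∈ truncSeq E z r i, dist e e' ≤ R ∧
      E ∩ closedBall e' (R / 4) ⊆ truncSet E z r := by
  have hr : 0 < r := hR.trans_le hRr
  have key : ∀ k : ℕ, R ≤ r / 2 ^ k → ∀ e' ∈ truncSeq E z r k,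
      E ∩ closedBall e' (R / 4) ⊆ truncSet E z r := by
    intro k hk e' he' y hy
    refine truncSeq_subset_truncSet (k + 1) ?_
    simp only [truncSeq, mem_iUnion, exists_prop]
    refine ⟨e', he', hy.1, closedBall_subset_closedBall ?_ hy.2⟩
    have : r / 2 ^ (k + 2) = r / 2 ^ k / 4 := by rw [pow_add]; field_simp; norm_num
    linarith
  obtain ⟨i, hi1, hi2⟩ := exists_nat_pow_near ((one_le_div hR).2 hRr) (one_lt_two : (1 : ℝ) < 2)
  have hi1' : R ≤ r / 2 ^ i := by
    rw [le_div_iff₀ hR] at hi1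
    rw [le_div_iff₀ (by positivity)]
    linarith
  have hi2' : r / 2 ^ (i + 1) ≤ R := by
    rw [div_lt_iff₀ hR] at hi2
    rw [div_le_iff₀ (by positivity)]
    linarith
  rcases le_total i j with hij | hji
  · obtain ⟨e', he', hd⟩ := exists_ancestor_truncSeq hij he
    have : 0 < r / 2 ^ (j + 1) := by positivity
    exact ⟨i, e', he', by linarith, key i hi1' e' he'⟩
  · refine ⟨j, e, he, by simpa using hR.le, key j (hi1'.trans ?_) e he⟩
    gcongr
    norm_num

lemma infDist_eq_of_inter_closedBall_subset {F : Set X} {e y : X} {R : ℝ} (hFE : F ⊆ E)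
    (heF : e ∈ F) (h : E ∩ closedBall e (2 * R) ⊆ F) (hy : y ∈ ball e R) :
    infDist y E = infDist y F := by
  refine le_antisymm (infDist_le_infDist_of_subset hFE ⟨e, heF⟩) ?_
  by_contra! hlt
  obtain ⟨f, hfE, hf⟩ := (infDist_lt_iff ⟨e, hFE heF⟩).1 hlt
  have h1 : infDist y F ≤ dist y e := infDist_le_dist_of_mem heF
  have h2 := dist_triangle f y e
  rw [dist_comm f y] at h2
  rw [mem_ball] at hy
  have h3 : f ∈ F := h ⟨hfE, by rw [mem_closedBall]; linarith⟩
  exact absurd (infDist_le_dist_of_mem (x := y) h3) (by linarith)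

/-- Every point `x` of `ball z (8 * r)` off the truncated set has a nearby ball of radius
comparable to the distance from `x` to the truncated set, centred at the truncated set, in which
the distances to `E` and to the truncated set agree. -/
lemma exists_ball_infDist_eq (hE : IsClosed E) (hz : z ∈ E) (hr : 0 < r) {x : X}
    (hx : x ∈ ball z (8 * r)) (hxF : 0 < infDist x (truncSet E z r)) :
    ∃ e ∈ E, dist x e ≤ 3 * infDist x (truncSet E z r) ∧
      ball e (infDist x (truncSet E z r) / 64) ⊆ ball z (8 * r) ∧
      ∀ y ∈ ball e (infDist x (truncSet E z r) / 64),
        infDist y E = infDist y (truncSet E z r) := by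
  set F := truncSet E z r with hF
  set D := infDist x F with hD
  have hne : (⋃ j, truncSeq E z r j).Nonempty :=
    ⟨z, mem_iUnion.2 ⟨0, hz, mem_closedBall_self (by positivity)⟩⟩
  have hDr : D < 8 * r := (infDist_le_dist_of_mem (center_mem_truncSet hz hr)).trans_lt hx
  have hlt : infDist x (⋃ j, truncSeq E z r j) < 2 * D := by
    rw [← infDist_closure]
    change D < 2 * D
    linarith
  obtain ⟨f, hf, hxf⟩ := (infDist_lt_iff hne).1 hlt
  obtain ⟨j, hj⟩ := mem_iUnion.1 hf
  obtain ⟨i, e, he, hfe, hsub⟩ := exists_near_inter_closedBall_subset_truncSet hj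
    (R := D / 8) (by positivity) (by linarith)
  have hez : dist e z ≤ r := truncSeq_subset_closedBall hr i he
  refine ⟨e, truncSeq_subset i he, ?_, ball_subset_ball' (by linarith), fun y hy => ?_⟩
  · have := dist_triangle x f e
    linarith
  · refine infDist_eq_of_inter_closedBall_subset (truncSet_subset hE)
      (truncSeq_subset_truncSet i he) ?_ hy
    exact (inter_subset_inter_right _ (closedBall_subset_closedBall (by linarith))).trans hsub

end Truncation

section Doubling

variable {X : Type*} [MetricSpace X] [MeasurableSpace X] {μ : Measure X}

lemma sigmaFinite_of_ball_lt_top [Nonempty X] (hball : ∀ (x : X) (ρ : ℝ), 0 < ρ → μ (ball x ρ) < ⊤) :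
    SigmaFinite μ := by
  obtain ⟨x⟩ := ‹Nonempty X›
  refine ⟨⟨⟨fun n : ℕ => ball x (n + 1), fun _ => trivial,
    fun n => hball x _ (by positivity), ?_⟩⟩⟩
  refine eq_univ_of_forall fun y => mem_iUnion.2 ?_
  obtain ⟨n, hn⟩ := exists_nat_gt (dist y x)
  exact ⟨n, by rw [mem_ball]; linarith⟩

lemma secondCountable_of_ball_pos [OpensMeasurableSpace X] [SFinite μ]
    (hball : ∀ (x : X) (ρ : ℝ), 0 < ρ → 0 < μ (ball x ρ)) :
    SecondCountableTopology X := by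
  refine secondCountable_of_almost_dense_set fun ε hε => ?_
  obtain ⟨S, hS⟩ := zorn_subset {S : Set X | S.Pairwise fun x y => ε ≤ dist x y} (by
    intro c hc hchain
    refine ⟨⋃₀ c, ?_, fun s hs => subset_sUnion_of_mem hs⟩
    exact (pairwise_sUnion hchain.directedOn).2 fun s hs => hc hs)
  refine ⟨S, ?_, fun x => ?_⟩
  · have hdisj : Pairwise (Function.onFun Disjoint fun x : S => ball (x : X) (ε / 2)) := by
      intro x y hxy
      refine ball_disjoint_ball ?_
      have := hS.prop x.2 y.2 (fun h => hxy (Subtype.ext h))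
      linarith
    have := Measure.countable_meas_pos_of_disjoint_iUnion (μ := μ)
      (As := fun x : S => ball (x : X) (ε / 2)) (fun _ => measurableSet_ball) hdisj
    rw [← countable_coe_iff]
    rw [eq_univ_of_forall (s := {x : S | 0 < μ (ball (x : X) (ε / 2))})
      fun x => hball _ _ (by positivity)] at this
    exact countable_univ_iff.1 this
  · by_contra! h
    have hmem : insert x S ∈ {S : Set X | S.Pairwise fun x y => ε ≤ dist x y} := by
      refine pairwise_insert.2 ⟨hS.prop, fun y hy _ => ⟨(h y hy).le, ?_⟩⟩
      rw [dist_comm]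
      exact (h y hy).le
    have hx : x ∈ S := hS.le_of_ge hmem (subset_insert x S) (mem_insert x S)
    have := h x hx
    rw [dist_self] at this
    linarith

lemma measure_ball_two_pow_mul_le {c : ℝ≥0∞}
    (hdoubling : ∀ (x : X) (ρ : ℝ), 0 < ρ → μ (ball x (2 * ρ)) ≤ c * μ (ball x ρ))
    (x : X) {ρ : ℝ} (hρ : 0 < ρ) (n : ℕ) :
    μ (ball x (2 ^ n * ρ)) ≤ c ^ n * μ (ball x ρ) := by
  induction n with
  | zero => simp
  | succ n ih =>
    calc μ (ball x (2 ^ (n + 1) * ρ)) = μ (ball x (2 * (2 ^ n * ρ))) := by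
          rw [pow_succ', mul_assoc]
      _ ≤ c * μ (ball x (2 ^ n * ρ)) := hdoubling x _ (by positivity)
      _ ≤ c * (c ^ n * μ (ball x ρ)) := by gcongr
      _ = c ^ (n + 1) * μ (ball x ρ) := by rw [pow_succ', mul_assoc]

lemma measurable_measure_ball [OpensMeasurableSpace X] [SecondCountableTopology X] [SFinite μ]
    {f : X → ℝ} (hf : Measurable f) : Measurable fun x => μ (ball x (f x)) := by
  have hs : MeasurableSet {q : X × X | dist q.2 q.1 < f q.1} :=
    measurableSet_lt (measurable_snd.dist measurable_fst) (hf.comp measurable_fst)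
  exact measurable_measure_prodMk_left hs

end Doubling

section Estimates

lemma ENNReal.inv_le_mul_inv {a b C : ℝ≥0∞} (ha0 : a ≠ 0) (ha : a ≠ ⊤) (h : a ≤ C * b) :
    b⁻¹ ≤ C * a⁻¹ :=
  calc b⁻¹ = b⁻¹ * (a * a⁻¹) := by rw [ENNReal.mul_inv_cancel ha0 ha, mul_one]
    _ ≤ b⁻¹ * (C * b * a⁻¹) := by gcongr
    _ = C * a⁻¹ * (b⁻¹ * b) := by ring
    _ ≤ C * a⁻¹ * 1 := by gcongr; exact ENNReal.inv_mul_le_one b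
    _ = C * a⁻¹ := mul_one _

lemma ENNReal.le_two_mul_of_le_half_mul_add {a b : ℝ≥0∞} (ha : a ≠ ⊤) (h : a ≤ 2⁻¹ * a + b) :
    a ≤ 2 * b := by
  have h2 : 2⁻¹ * a + 2⁻¹ * a = a := by
    rw [← add_mul, ENNReal.inv_two_add_inv_two, one_mul]
  have h3 : 2⁻¹ * a ≠ ⊤ := ENNReal.mul_ne_top (by simp) ha
  have h4 : 2⁻¹ * a ≤ b := by
    rw [← ENNReal.add_le_add_iff_left h3, h2]
    exact h
  calc a = 2 * (2⁻¹ * a) := by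
        rw [← mul_assoc, ENNReal.mul_inv_cancel two_ne_zero ENNReal.ofNat_ne_top, one_mul]
    _ ≤ 2 * b := by gcongr

lemma ofReal_abs_rpow_le {p : ℝ} (hp : 1 ≤ p) (a b : ℝ) :
    ENNReal.ofReal (|a| ^ p) ≤
      2 ^ (p - 1) * (ENNReal.ofReal (|b| ^ p) + ENNReal.ofReal (|a - b| ^ p)) := by
  have hp0 : 0 ≤ p := by linarith
  simp only [← ENNReal.ofReal_rpow_of_nonneg (abs_nonneg _) hp0]
  refine le_trans ?_ (ENNReal.rpow_add_le_mul_rpow_add_rpow _ _ hp)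
  rw [← ENNReal.ofReal_add (abs_nonneg _) (abs_nonneg _)]
  gcongr
  calc |a| = |b + (a - b)| := by congr 1; ring
    _ ≤ _ := abs_add_le _ _

variable {X : Type*} [MeasurableSpace X] {μ : Measure X}

lemma ofReal_abs_rpow_mul_lintegral_le {p : ℝ} (hp : 1 ≤ p) {u : X → ℝ} (hu : Measurable u)
    {v : X → ℝ≥0∞} (hv : Measurable v) (a : ℝ) (S : Set X) :
    ENNReal.ofReal (|a| ^ p) * ∫⁻ y in S, v y ∂μ ≤
      2 ^ (p - 1) * (∫⁻ y in S, ENNReal.ofReal (|u y| ^ p) * v y ∂μ +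
        ∫⁻ y in S, ENNReal.ofReal (|a - u y| ^ p) * v y ∂μ) := by
  have hm : Measurable fun y => ENNReal.ofReal (|u y| ^ p) * v y := by fun_prop
  rw [← lintegral_const_mul _ hv, ← lintegral_add_left hm,
    ← lintegral_const_mul' _ _ (ENNReal.rpow_ne_top_of_nonneg (by linarith) (by simp))]
  refine lintegral_mono fun y => ?_
  rw [← add_mul, ← mul_assoc]
  gcongr
  exact ofReal_abs_rpow_le hp a (u y)

/-- If a set `B` satisfies the Aikawa inequality with weight `D ^ (-α)`, then the values of a
function vanishing where `D` does are controlled by a small multiple of the weighted mean of the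
function over `B` and a large multiple of its mean oscillation. -/
lemma ofReal_abs_rpow_mul_measure_le {p α ε δ R : ℝ} (hp : 1 ≤ p) (hα : 0 < α) (hε : 0 < ε)
    (hδ : 0 < δ) (hR : 0 < R) {B : Set X} (hB : MeasurableSet B) (hB0 : μ B ≠ 0) (hBt : μ B ≠ ⊤)
    {D : X → ℝ} (hD : Measurable D) (hD0 : ∀ y, 0 ≤ D y) {u : X → ℝ} (hu : Measurable u)
    (huD : ∀ y, D y = 0 → u y = 0)
    (haik : ∀ K : Set X, MeasurableSet K → μ (B \ K) ≤ ENNReal.ofReal δ * μ B →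
      ENNReal.ofReal (R ^ (-α) / ε) ≤
        (μ B)⁻¹ * ∫⁻ y in B ∩ K, ENNReal.ofReal (D y ^ (-α)) ∂μ) (a : ℝ) :
    ENNReal.ofReal (|a| ^ p) * μ B ≤
      2 ^ (p - 1) * (ENNReal.ofReal (ε * R ^ α) *
          ∫⁻ y in B, ENNReal.ofReal (|u y| ^ p) * ENNReal.ofReal (D y ^ (-α)) ∂μ +
        ENNReal.ofReal δ⁻¹ * ∫⁻ y in B, ENNReal.ofReal (|a - u y| ^ p) ∂μ) := by
  have hp0 : 0 < p := by linarith
  set τ : ℝ := (ε * δ) ^ α⁻¹ with hτ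
  have hτ0 : 0 < τ := by positivity
  have hτα : τ ^ α = ε * δ := Real.rpow_inv_rpow (by positivity) hα.ne'
  have hRα : 0 < R ^ α := by positivity
  have hτR : (τ * R) ^ α = ε * δ * R ^ α := by rw [Real.mul_rpow hτ0.le hR.le, hτα]
  set K : Set X := {y | τ * R ≤ D y} with hK
  have hKm : MeasurableSet K := measurableSet_le measurable_const hD
  set I := ∫⁻ y in B, ENNReal.ofReal (|u y| ^ p) * ENNReal.ofReal (D y ^ (-α)) ∂μ with hI
  set J := ∫⁻ y in B, ENNReal.ofReal (|a - u y| ^ p) ∂μ with hJ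
  have hw : Measurable fun y => ENNReal.ofReal (D y ^ (-α)) := by fun_prop
  by_cases hcase : μ (B \ K) ≤ ENNReal.ofReal δ * μ B
  · have h1 : μ B ≤ ENNReal.ofReal (ε * R ^ α) *
        ∫⁻ y in B ∩ K, ENNReal.ofReal (D y ^ (-α)) ∂μ := by
      calc μ B = ENNReal.ofReal (ε * R ^ α) * (μ B * ENNReal.ofReal (R ^ (-α) / ε)) := by
            rw [mul_left_comm, ← ENNReal.ofReal_mul (by positivity), Real.rpow_neg hR.le]
            have : ε * R ^ α * ((R ^ α)⁻¹ / ε) = 1 := by field_simp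
            rw [this]; simp
        _ ≤ ENNReal.ofReal (ε * R ^ α) * (μ B * ((μ B)⁻¹ *
              ∫⁻ y in B ∩ K, ENNReal.ofReal (D y ^ (-α)) ∂μ)) := by
            gcongr
            exact haik K hKm hcase
        _ = _ := by
            rw [← mul_assoc (μ B), ENNReal.mul_inv_cancel hB0 hBt, one_mul]
    have h2 : ∫⁻ y in B ∩ K, ENNReal.ofReal (|a - u y| ^ p) * ENNReal.ofReal (D y ^ (-α)) ∂μ ≤
        ENNReal.ofReal (ε * δ * R ^ α)⁻¹ * J := by
      rw [hJ, ← lintegral_const_mul' _ _ ENNReal.ofReal_ne_top]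
      refine (setLIntegral_mono' (hB.inter hKm) fun y hy => ?_).trans
        (lintegral_mono_set inter_subset_left)
      rw [mul_comm]
      gcongr
      rw [Real.rpow_neg (hD0 y), ← hτR]
      have : τ * R ≤ D y := hy.2
      gcongr
    calc ENNReal.ofReal (|a| ^ p) * μ B
        ≤ ENNReal.ofReal (|a| ^ p) * (ENNReal.ofReal (ε * R ^ α) *
            ∫⁻ y in B ∩ K, ENNReal.ofReal (D y ^ (-α)) ∂μ) := by gcongr
      _ = ENNReal.ofReal (ε * R ^ α) * (ENNReal.ofReal (|a| ^ p) *
            ∫⁻ y in B ∩ K, ENNReal.ofReal (D y ^ (-α)) ∂μ) := by ring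
      _ ≤ ENNReal.ofReal (ε * R ^ α) * (2 ^ (p - 1) * (I +
            ENNReal.ofReal (ε * δ * R ^ α)⁻¹ * J)) := by
          gcongr ENNReal.ofReal (ε * R ^ α) * ?_
          refine (ofReal_abs_rpow_mul_lintegral_le hp hu hw a _).trans ?_
          gcongr
          exact lintegral_mono_set inter_subset_left
      _ = 2 ^ (p - 1) * (ENNReal.ofReal (ε * R ^ α) * I +
            (ENNReal.ofReal (ε * R ^ α) * ENNReal.ofReal (ε * δ * R ^ α)⁻¹) * J) := by ring
      _ = _ := by
          rw [← ENNReal.ofReal_mul (by positivity)]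
          congr 5
          field_simp
  · have h1 : μ B ≤ ENNReal.ofReal δ⁻¹ * μ (B \ K) := by
      calc μ B = ENNReal.ofReal δ⁻¹ * (ENNReal.ofReal δ * μ B) := by
            rw [← mul_assoc, ← ENNReal.ofReal_mul (by positivity), inv_mul_cancel₀ hδ.ne']
            simp
        _ ≤ _ := by gcongr; exact (not_le.1 hcase).le
    have h2 : ∫⁻ y in B \ K, ENNReal.ofReal (|u y| ^ p) ∂μ ≤
        ENNReal.ofReal (ε * δ * R ^ α) * I := by
      rw [hI, ← lintegral_const_mul' _ _ ENNReal.ofReal_ne_top]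
      refine (setLIntegral_mono' (hB.diff hKm) fun y hy => ?_).trans
        (lintegral_mono_set sdiff_subset)
      have hlt : D y < τ * R := not_le.1 hy.2
      rcases (hD0 y).eq_or_lt with h0 | h0
      · simp [huD y h0.symm, Real.zero_rpow hp0.ne']
      · rw [mul_left_comm, ← ENNReal.ofReal_mul (by positivity)]
        refine le_mul_of_one_le_right' ?_
        rw [ENNReal.one_le_ofReal, ← hτR, Real.rpow_neg h0.le, ← div_eq_mul_inv,
          one_le_div (by positivity)]
        gcongr
    calc ENNReal.ofReal (|a| ^ p) * μ B
        ≤ ENNReal.ofReal (|a| ^ p) * (ENNReal.ofReal δ⁻¹ * μ (B \ K)) := by gcongr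
      _ = ENNReal.ofReal δ⁻¹ * (ENNReal.ofReal (|a| ^ p) * ∫⁻ _ in B \ K, 1 ∂μ) := by
          rw [setLIntegral_one]; ring
      _ ≤ ENNReal.ofReal δ⁻¹ * (2 ^ (p - 1) * (ENNReal.ofReal (ε * δ * R ^ α) * I + J)) := by
          gcongr ENNReal.ofReal δ⁻¹ * ?_
          refine (ofReal_abs_rpow_mul_lintegral_le hp hu measurable_const a _).trans ?_
          simp only [mul_one]
          gcongr
          exact lintegral_mono_set sdiff_subset
      _ = 2 ^ (p - 1) * ((ENNReal.ofReal δ⁻¹ * ENNReal.ofReal (ε * δ * R ^ α)) * I +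
            ENNReal.ofReal δ⁻¹ * J) := by ring
      _ = _ := by
          rw [← ENNReal.ofReal_mul (by positivity)]
          congr 4
          field_simp

end Estimates

section Hardy

variable {X : Type*} [MetricSpace X] [MeasurableSpace X] [BorelSpace X] {μ : Measure X}
  {c : ℝ≥0∞}

lemma lintegral_indicator_rpow_div_measure_ball_le
    (hball : ∀ (x : X) (ρ : ℝ), 0 < ρ → 0 < μ (ball x ρ) ∧ μ (ball x ρ) < ⊤)
    (hdoubling : ∀ (x : X) (ρ : ℝ), 0 < ρ → μ (ball x (2 * ρ)) ≤ c * μ (ball x ρ))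
    {D : X → ℝ} (hD : ∀ x y, D y ≤ D x + dist x y) {γ : ℝ} (hγ : 0 < γ) {y : X} (hy : 0 < D y) :
    ∫⁻ x, {x | dist x y < 4 * D x}.indicator
        (fun x => ENNReal.ofReal (D x ^ (-γ)) * (μ (ball x (4 * D x)))⁻¹) x ∂μ ≤
      c ^ 2 * (1 - ENNReal.ofReal (2 ^ (-γ)))⁻¹ * ENNReal.ofReal (5 ^ γ) *
        ENNReal.ofReal (D y ^ (-γ)) := by
  set t : ℝ := D y / 5 with ht
  have ht0 : 0 < t := by positivity
  set f : ℕ → X → ℝ≥0∞ := fun k => (ball y (2 ^ (k + 3) * t)).indicator fun _ =>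
    ENNReal.ofReal ((2 ^ k * t) ^ (-γ)) * (c ^ 2 * (μ (ball y (2 ^ (k + 3) * t)))⁻¹) with hf
  have hle : ∀ x, {x | dist x y < 4 * D x}.indicator
      (fun x => ENNReal.ofReal (D x ^ (-γ)) * (μ (ball x (4 * D x)))⁻¹) x ≤ ∑' k, f k x := by
    intro x
    by_cases hx : dist x y < 4 * D x
    · have hDx : t < D x := by linarith [hD x y]
      obtain ⟨k, hk1, hk2⟩ := exists_nat_pow_near ((one_le_div ht0).2 hDx.le)
        (one_lt_two : (1 : ℝ) < 2)
      rw [le_div_iff₀ ht0] at hk1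
      rw [div_lt_iff₀ ht0] at hk2
      have hmem : x ∈ ball y (2 ^ (k + 3) * t) := by
        rw [mem_ball]
        have : (2 : ℝ) ^ (k + 3) * t = 4 * (2 ^ (k + 1) * t) := by ring
        linarith
      refine le_trans ?_ (ENNReal.le_tsum k)
      rw [indicator_of_mem (by exact hx), hf]
      simp only
      rw [indicator_of_mem hmem]
      have h1 : D x ^ (-γ) ≤ (2 ^ k * t) ^ (-γ) :=
        Real.rpow_le_rpow_of_nonpos (by positivity) hk1 (by linarith)
      have h2 : (μ (ball x (4 * D x)))⁻¹ ≤ c ^ 2 * (μ (ball y (2 ^ (k + 3) * t)))⁻¹ := by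
        have hb := hball y (2 ^ (k + 3) * t) (by positivity)
        refine ENNReal.inv_le_mul_inv hb.1.ne' hb.2.ne ?_
        refine le_trans (measure_mono (ball_subset_ball' ?_))
          (measure_ball_two_pow_mul_le hdoubling x (by linarith) 2)
        have : (2 : ℝ) ^ (k + 3) * t = 8 * (2 ^ k * t) := by ring
        rw [dist_comm]
        linarith
      gcongr
    · rw [indicator_of_notMem (by exact hx)]
      exact zero_le
  have hfm : ∀ k, Measurable (f k) := fun k => measurable_const.indicator measurableSet_ball
  have hint : ∀ k, ∫⁻ x, f k x ∂μ =
      ENNReal.ofReal (2 ^ (-γ)) ^ k * (c ^ 2 * ENNReal.ofReal (t ^ (-γ))) := by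
    intro k
    have hb := hball y (2 ^ (k + 3) * t) (by positivity)
    rw [lintegral_indicator_const measurableSet_ball, mul_assoc, mul_assoc,
      ENNReal.inv_mul_cancel hb.1.ne' hb.2.ne, mul_one, Real.mul_rpow (by positivity) ht0.le,
      ENNReal.ofReal_mul (by positivity), ← Real.rpow_natCast, ← Real.rpow_mul two_pos.le,
      mul_comm (k : ℝ), Real.rpow_mul two_pos.le, Real.rpow_natCast,
      ENNReal.ofReal_pow (by positivity)]
    ring
  calc _ ≤ ∫⁻ x, ∑' k, f k x ∂μ := lintegral_mono hle
    _ = ∑' k, ∫⁻ x, f k x ∂μ := lintegral_tsum fun k => (hfm k).aemeasurable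
    _ = (1 - ENNReal.ofReal (2 ^ (-γ)))⁻¹ * (c ^ 2 * ENNReal.ofReal (t ^ (-γ))) := by
        simp_rw [hint]
        rw [ENNReal.tsum_mul_right, ENNReal.tsum_geometric]
    _ = _ := by
        rw [ht, Real.div_rpow hy.le (by norm_num), Real.rpow_neg (by norm_num : (0 : ℝ) ≤ 5),
          div_inv_eq_mul, ENNReal.ofReal_mul (by positivity)]
        ring

/-- Multiplying the pointwise bound by the Hardy weight and replacing the ball `ball e R` by a
comparable ball centred at `x`. -/
lemma ofReal_abs_rpow_div_le
    (hball : ∀ (x : X) (ρ : ℝ), 0 < ρ → 0 < μ (ball x ρ) ∧ μ (ball x ρ) < ⊤)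
    (hdoubling : ∀ (x : X) (ρ : ℝ), 0 < ρ → μ (ball x (2 * ρ)) ≤ c * μ (ball x ρ))
    {p s α ε δ : ℝ} (hp : 1 ≤ p) (hs : 0 < s) (hα : 0 < α) (hε : 0 < ε) (hδ : 0 < δ)
    {D : X → ℝ} (hD : Measurable D) (hD0 : ∀ y, 0 ≤ D y) {u : X → ℝ} (hu : Measurable u)
    (huD : ∀ y, D y = 0 → u y = 0) {x e : X} (hx : 0 < D x) (hxe : dist x e ≤ 3 * D x)
    {Ω : Set X} (hΩ : ball e (D x / 64) ⊆ Ω)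
    (haik : ∀ K : Set X, MeasurableSet K →
      μ (ball e (D x / 64) \ K) ≤ ENNReal.ofReal δ * μ (ball e (D x / 64)) →
      ENNReal.ofReal ((D x / 64) ^ (-α) / ε) ≤ (μ (ball e (D x / 64)))⁻¹ *
        ∫⁻ y in ball e (D x / 64) ∩ K, ENNReal.ofReal (D y ^ (-α)) ∂μ) :
    ENNReal.ofReal (|u x| ^ p) / ENNReal.ofReal (D x ^ (s * p)) ≤
      2 ^ (p - 1) * c ^ 9 * ENNReal.ofReal ε *
        ∫⁻ y in Ω, {q : X × X | dist q.1 q.2 < 4 * D q.1}.indicator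
          (fun q => ENNReal.ofReal (D q.1 ^ (-(s * p - α))) * (μ (ball q.1 (4 * D q.1)))⁻¹)
            (x, y) * (ENNReal.ofReal (|u y| ^ p) * ENNReal.ofReal (D y ^ (-α))) ∂μ +
      2 ^ (p - 1) * c ^ 9 * ENNReal.ofReal δ⁻¹ * ENNReal.ofReal (4 ^ (s * p)) *
        ∫⁻ y in Ω, fracKernel μ s p u x y ∂μ := by
  set R := D x / 64 with hR
  set B := ball e R with hB
  set V := μ (ball x (4 * D x)) with hV
  have hR0 : 0 < R := by positivity
  have hb := hball e R hR0
  have hsp : 0 < s * p := by positivity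
  have hBx : ∀ y ∈ B, dist x y < 4 * D x := by
    intro y hy
    have h1 := dist_triangle x e y
    have h2 : dist y e < R := hy
    rw [dist_comm y e] at h2
    linarith
  have hVB : (μ B)⁻¹ ≤ c ^ 9 * V⁻¹ := by
    have hb' := hball x (4 * D x) (by positivity)
    refine ENNReal.inv_le_mul_inv hb'.1.ne' hb'.2.ne ?_
    refine le_trans (measure_mono (ball_subset_ball' ?_))
      (measure_ball_two_pow_mul_le hdoubling e hR0 9)
    norm_num
    linarith
  have hVt : V⁻¹ ≠ ⊤ := ENNReal.inv_ne_top.2 (hball x (4 * D x) (by positivity)).1.ne'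
  have hDsp : 0 < D x ^ (s * p) := by positivity
  set W := (ENNReal.ofReal (D x ^ (s * p)))⁻¹ with hW
  have hWt : W ≠ ⊤ := ENNReal.inv_ne_top.2 (ENNReal.ofReal_pos.2 hDsp).ne'
  set I := ∫⁻ y in B, ENNReal.ofReal (|u y| ^ p) * ENNReal.ofReal (D y ^ (-α)) ∂μ with hI
  set J := ∫⁻ y in B, ENNReal.ofReal (|u x - u y| ^ p) ∂μ with hJ
  have hmain := ofReal_abs_rpow_mul_measure_le hp hα hε hδ hR0 measurableSet_ball hb.1.ne'
    hb.2.ne hD hD0 hu huD haik (u x)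
  have hεW : ENNReal.ofReal (ε * R ^ α) * W ≤
      ENNReal.ofReal ε * ENNReal.ofReal (D x ^ (-(s * p - α))) := by
    rw [hW, ← ENNReal.ofReal_inv_of_pos hDsp, ← ENNReal.ofReal_mul (by positivity),
      ← ENNReal.ofReal_mul hε.le]
    refine ENNReal.ofReal_le_ofReal ?_
    rw [mul_assoc]
    gcongr
    rw [neg_sub, Real.rpow_sub hx, div_eq_mul_inv]
    gcongr
    linarith
  have hI' : ENNReal.ofReal (D x ^ (-(s * p - α))) * V⁻¹ * I ≤
      ∫⁻ y in Ω, {q : X × X | dist q.1 q.2 < 4 * D q.1}.indicator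
          (fun q => ENNReal.ofReal (D q.1 ^ (-(s * p - α))) * (μ (ball q.1 (4 * D q.1)))⁻¹)
            (x, y) * (ENNReal.ofReal (|u y| ^ p) * ENNReal.ofReal (D y ^ (-α))) ∂μ := by
    rw [hI, ← lintegral_const_mul' _ _ (ENNReal.mul_ne_top ENNReal.ofReal_ne_top hVt)]
    refine (setLIntegral_mono' measurableSet_ball fun y hy => ?_).trans (lintegral_mono_set hΩ)
    rw [indicator_of_mem (by exact hBx y hy)]
  have hJ' : W * V⁻¹ * J ≤
      ENNReal.ofReal (4 ^ (s * p)) * ∫⁻ y in Ω, fracKernel μ s p u x y ∂μ := by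
    rw [hJ, ← lintegral_const_mul' _ _ (ENNReal.mul_ne_top hWt hVt),
      ← lintegral_const_mul' _ _ ENNReal.ofReal_ne_top]
    refine (setLIntegral_mono' measurableSet_ball fun y hy => ?_).trans (lintegral_mono_set hΩ)
    have hxy := hBx y hy
    have h4 : W ≤ ENNReal.ofReal (4 ^ (s * p)) * (ENNReal.ofReal (dist x y ^ (s * p)))⁻¹ := by
      refine ENNReal.inv_le_iff_inv_le.2 ?_
      rw [ENNReal.mul_inv (Or.inl (by positivity)) (Or.inl ENNReal.ofReal_ne_top), inv_inv,
        ← ENNReal.ofReal_inv_of_pos (by positivity), ← ENNReal.ofReal_mul (by positivity)]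
      refine ENNReal.ofReal_le_ofReal ?_
      rw [inv_mul_le_iff₀ (by positivity), ← Real.mul_rpow (by norm_num) hx.le]
      gcongr
    calc W * V⁻¹ * ENNReal.ofReal (|u x - u y| ^ p)
        ≤ ENNReal.ofReal (4 ^ (s * p)) * (ENNReal.ofReal (dist x y ^ (s * p)))⁻¹ *
          (μ (ball x (dist x y)))⁻¹ * ENNReal.ofReal (|u x - u y| ^ p) := by
          gcongr
          exact measure_mono (ball_subset_ball hxy.le)
      _ ≤ ENNReal.ofReal (4 ^ (s * p)) * fracKernel μ s p u x y := by
          rcases eq_or_ne x y with rfl | hne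
          · simp [Real.zero_rpow (by linarith : p ≠ 0)]
          · have hd : 0 < dist x y := dist_pos.2 hne
            rw [fracKernel, ENNReal.div_eq_inv_mul,
              ENNReal.mul_inv (Or.inr (hball x _ hd).2.ne) (Or.inl ENNReal.ofReal_ne_top)]
            simp only [mul_assoc, le_refl]
  calc ENNReal.ofReal (|u x| ^ p) / ENNReal.ofReal (D x ^ (s * p))
      = ENNReal.ofReal (|u x| ^ p) * μ B * ((μ B)⁻¹ * W) := by
        rw [mul_assoc, ← mul_assoc (μ B), ENNReal.mul_inv_cancel hb.1.ne' hb.2.ne, one_mul,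
          div_eq_mul_inv]
    _ ≤ 2 ^ (p - 1) * (ENNReal.ofReal (ε * R ^ α) * I + ENNReal.ofReal δ⁻¹ * J) *
          (c ^ 9 * V⁻¹ * W) := by gcongr
    _ = 2 ^ (p - 1) * c ^ 9 * (ENNReal.ofReal (ε * R ^ α) * W) * V⁻¹ * I +
          2 ^ (p - 1) * c ^ 9 * ENNReal.ofReal δ⁻¹ * (W * V⁻¹ * J) := by ring
    _ ≤ 2 ^ (p - 1) * c ^ 9 * (ENNReal.ofReal ε * ENNReal.ofReal (D x ^ (-(s * p - α)))) *
          V⁻¹ * I + 2 ^ (p - 1) * c ^ 9 * ENNReal.ofReal δ⁻¹ * (ENNReal.ofReal (4 ^ (s * p)) *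
          ∫⁻ y in Ω, fracKernel μ s p u x y ∂μ) := by gcongr
    _ = 2 ^ (p - 1) * c ^ 9 * ENNReal.ofReal ε * (ENNReal.ofReal (D x ^ (-(s * p - α))) *
          V⁻¹ * I) + 2 ^ (p - 1) * c ^ 9 * ENNReal.ofReal δ⁻¹ * ENNReal.ofReal (4 ^ (s * p)) *
          ∫⁻ y in Ω, fracKernel μ s p u x y ∂μ := by ring
    _ ≤ _ := by gcongr

lemma measurable_indicator_rpow_div_measure_ball [SecondCountableTopology X] [SFinite μ]
    {D : X → ℝ} (hD : Measurable D) (γ : ℝ) :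
    Measurable ({q : X × X | dist q.1 q.2 < 4 * D q.1}.indicator
      fun q => ENNReal.ofReal (D q.1 ^ (-γ)) * (μ (ball q.1 (4 * D q.1)))⁻¹) := by
  refine Measurable.indicator ?_ (measurableSet_lt (measurable_fst.dist measurable_snd)
    ((hD.comp measurable_fst).const_mul 4))
  have h : Measurable fun x => ENNReal.ofReal (D x ^ (-γ)) * (μ (ball x (4 * D x)))⁻¹ :=
    (hD.pow_const _).ennreal_ofReal.mul (measurable_measure_ball (hD.const_mul 4)).inv
  exact h.comp measurable_fst

lemma lintegral_lintegral_indicator_mul_le [SecondCountableTopology X] [SFinite μ]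
    (hball : ∀ (x : X) (ρ : ℝ), 0 < ρ → 0 < μ (ball x ρ) ∧ μ (ball x ρ) < ⊤)
    (hdoubling : ∀ (x : X) (ρ : ℝ), 0 < ρ → μ (ball x (2 * ρ)) ≤ c * μ (ball x ρ))
    {p s α : ℝ} (hp : 0 < p) (hαp : α < s * p) {F : Set X} (hF : IsClosed F) (hFne : F.Nonempty)
    {u : X → ℝ} (hu : Measurable u) (huF : ∀ x ∈ F, u x = 0) (Ω : Set X) (Ω' : Set X)
    (hΩ : MeasurableSet Ω) :
    ∫⁻ x in Ω', ∫⁻ y in Ω, {q : X × X | dist q.1 q.2 < 4 * infDist q.1 F}.indicator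
        (fun q => ENNReal.ofReal (infDist q.1 F ^ (-(s * p - α))) *
          (μ (ball q.1 (4 * infDist q.1 F)))⁻¹) (x, y) *
        (ENNReal.ofReal (|u y| ^ p) * ENNReal.ofReal (infDist y F ^ (-α))) ∂μ ∂μ ≤
      c ^ 2 * (1 - ENNReal.ofReal (2 ^ (-(s * p - α))))⁻¹ * ENNReal.ofReal (5 ^ (s * p - α)) *
        ∫⁻ y in Ω \ F, ENNReal.ofReal (|u y| ^ p) / ENNReal.ofReal (infDist y F ^ (s * p)) ∂μ := by
  set D : X → ℝ := fun x => infDist x F with hDdef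
  have hD : Measurable D := (continuous_infDist_pt F).measurable
  have hDtri : ∀ x y, D y ≤ D x + dist x y := fun x y => by
    rw [dist_comm]
    exact infDist_le_infDist_add_dist
  set G : X × X → ℝ≥0∞ := {q : X × X | dist q.1 q.2 < 4 * D q.1}.indicator
    (fun q => ENNReal.ofReal (D q.1 ^ (-(s * p - α))) * (μ (ball q.1 (4 * D q.1)))⁻¹) with hG
  set C := c ^ 2 * (1 - ENNReal.ofReal (2 ^ (-(s * p - α))))⁻¹ * ENNReal.ofReal (5 ^ (s * p - α))
  have hGm : Measurable G := measurable_indicator_rpow_div_measure_ball hD _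
  have hwm : Measurable fun y => ENNReal.ofReal (|u y| ^ p) * ENNReal.ofReal (D y ^ (-α)) := by
    fun_prop
  calc ∫⁻ x in Ω', ∫⁻ y in Ω, G (x, y) *
        (ENNReal.ofReal (|u y| ^ p) * ENNReal.ofReal (D y ^ (-α))) ∂μ ∂μ
      ≤ ∫⁻ x, ∫⁻ y in Ω, G (x, y) *
        (ENNReal.ofReal (|u y| ^ p) * ENNReal.ofReal (D y ^ (-α))) ∂μ ∂μ :=
        setLIntegral_le_lintegral _ _
    _ = ∫⁻ y in Ω, (∫⁻ x, G (x, y) ∂μ) *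
        (ENNReal.ofReal (|u y| ^ p) * ENNReal.ofReal (D y ^ (-α))) ∂μ := by
        rw [lintegral_lintegral_swap (hGm.mul (hwm.comp measurable_snd)).aemeasurable]
        refine lintegral_congr fun y => ?_
        exact lintegral_mul_const _ (hGm.comp measurable_prodMk_right)
    _ ≤ ∫⁻ y in Ω, (Ω \ F).indicator (fun y => C * (ENNReal.ofReal (|u y| ^ p) /
          ENNReal.ofReal (D y ^ (s * p)))) y ∂μ := by
        refine setLIntegral_mono' hΩ fun y hy => ?_
        by_cases hyF : y ∈ F
        · simp [huF y hyF, Real.zero_rpow hp.ne']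
        · have hDy : 0 < D y := (hF.notMem_iff_infDist_pos hFne).1 hyF
          rw [indicator_of_mem (show y ∈ Ω \ F from ⟨hy, hyF⟩), div_eq_mul_inv,
            ← ENNReal.ofReal_inv_of_pos (by positivity)]
          calc _ ≤ C * ENNReal.ofReal (D y ^ (-(s * p - α))) *
                (ENNReal.ofReal (|u y| ^ p) * ENNReal.ofReal (D y ^ (-α))) := by
                gcongr
                exact lintegral_indicator_rpow_div_measure_ball_le hball hdoubling hDtri
                  (sub_pos.2 hαp) hDy
            _ = C * (ENNReal.ofReal (|u y| ^ p) * (ENNReal.ofReal (D y ^ (-(s * p - α))) *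
                ENNReal.ofReal (D y ^ (-α)))) := by ring
            _ ≤ _ := by
                rw [← ENNReal.ofReal_mul (by positivity), ← Real.rpow_add hDy,
                  ← Real.rpow_neg hDy.le]
                have : -(s * p - α) + -α = -(s * p) := by ring
                rw [this]
    _ ≤ C * ∫⁻ y in Ω \ F, ENNReal.ofReal (|u y| ^ p) / ENNReal.ofReal (D y ^ (s * p)) ∂μ := by
        have hm : Measurable fun y => ENNReal.ofReal (|u y| ^ p) /
            ENNReal.ofReal (D y ^ (s * p)) := by fun_prop
        rw [← lintegral_const_mul _ hm, ← lintegral_indicator (hΩ.diff hF.measurableSet)]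
        exact setLIntegral_le_lintegral _ _

lemma lintegral_hardy_lt_top {p s ρ : ℝ} (hp : 1 ≤ p) (hs : s < 1) {F : Set X} (hF : IsClosed F)
    (hFne : F.Nonempty) {u : X → ℝ} {L : ℝ≥0} (hu : LipschitzWith L u) (huF : ∀ x ∈ F, u x = 0)
    {Ω : Set X} (hΩm : MeasurableSet Ω) (hΩ : μ Ω ≠ ⊤) (hρ : ∀ x ∈ Ω, infDist x F ≤ ρ) :
    ∫⁻ x in Ω \ F, ENNReal.ofReal (|u x| ^ p) / ENNReal.ofReal (infDist x F ^ (s * p)) ∂μ < ⊤ := by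
  have hp0 : 0 < p := by linarith
  have hbd : ∀ x ∈ Ω \ F, ENNReal.ofReal (|u x| ^ p) / ENNReal.ofReal (infDist x F ^ (s * p)) ≤
      ENNReal.ofReal ((L : ℝ) ^ p * ρ ^ (p - s * p)) := by
    intro x hx
    have hD : 0 < infDist x F := (hF.notMem_iff_infDist_pos hFne).1 hx.2
    have hux : |u x| ≤ L * infDist x F := by
      refine le_of_forall_pos_lt_add fun η hη => ?_
      obtain ⟨e, he, hxe⟩ := (infDist_lt_iff hFne).1
        (lt_add_of_pos_right (infDist x F) (div_pos hη (by positivity : (0 : ℝ) < L + 1)))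
      have h1 := hu.dist_le_mul x e
      rw [huF e he, Real.dist_eq, sub_zero] at h1
      calc |u x| ≤ L * dist x e := h1
        _ ≤ L * (infDist x F + η / (L + 1)) := by gcongr
        _ = L * infDist x F + η * (L / (L + 1)) := by ring
        _ < L * infDist x F + η := by
          gcongr
          refine mul_lt_of_lt_one_right hη ?_
          rw [div_lt_one (by positivity)]
          linarith
    rw [← ENNReal.ofReal_div_of_pos (by positivity)]
    refine ENNReal.ofReal_le_ofReal ?_
    rw [div_le_iff₀ (by positivity)]
    calc |u x| ^ p ≤ (L * infDist x F) ^ p := by gcongr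
      _ = (L : ℝ) ^ p * infDist x F ^ (p - s * p) * infDist x F ^ (s * p) := by
        rw [mul_assoc, ← Real.rpow_add hD, Real.mul_rpow (by positivity) hD.le]
        congr 2
        ring
      _ ≤ _ := by
        gcongr
        · nlinarith
        · exact hρ x hx.1
  calc _ ≤ ∫⁻ _ in Ω \ F, ENNReal.ofReal ((L : ℝ) ^ p * ρ ^ (p - s * p)) ∂μ :=
        setLIntegral_mono' (hΩm.diff hF.measurableSet) hbd
    _ = ENNReal.ofReal ((L : ℝ) ^ p * ρ ^ (p - s * p)) * μ (Ω \ F) := setLIntegral_const _ _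
    _ < ⊤ := ENNReal.mul_lt_top ENNReal.ofReal_lt_top
        ((measure_mono sdiff_subset).trans_lt hΩ.lt_top)

end Hardy

/-- Local fractional Hardy inequality: if a closed set `E` satisfies the upper Aikawa
condition with exponent `α = sq` (`1 < q < p < ∞`, `0 < s < 1`), then for the truncated
set `F` of `E` in `B(z,r)` there is a constant `C`, independent of `z` and `r`, such that
`∫_{B(z,8r)\F} |u|^p dist(·,F)^{-sp} dμ ≤ C [u]^p_{W^{s,p}(B(z,8r))}` for all Lipschitz
`u` vanishing on `F`. -/
theorem local_fractional_hardy {X : Type*} [MetricSpace X] [MeasurableSpace X] [BorelSpace X]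
    [Nontrivial X]
    (μ : Measure X) (c_μ : ℝ) (hc : 1 < c_μ)
    (hball : ∀ (x : X) (ρ : ℝ), 0 < ρ → 0 < μ (ball x ρ) ∧ μ (ball x ρ) < ⊤)
    (hdoubling : ∀ (x : X) (ρ : ℝ), 0 < ρ →
      μ (ball x (2 * ρ)) ≤ ENNReal.ofReal c_μ * μ (ball x ρ))
    (q p s : ℝ) (hq : 1 < q) (hqp : q < p) (hs0 : 0 < s) (hs1 : s < 1)
    (E : Set X) (hE : IsClosed E) (hEne : E.Nonempty)
    (haik : upperAikawaCond μ E (s * q)) :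
    ∃ C : ℝ, 0 < C ∧
      ∀ z ∈ E, ∀ r : ℝ, 0 < r → ENNReal.ofReal r < diamBound E →
        ∀ u : X → ℝ, (∃ L : ℝ≥0, LipschitzWith L u) →
          (∀ x ∈ truncSet E z r, u x = 0) →
          (∫⁻ x in ball z (8 * r) \ truncSet E z r,
              ENNReal.ofReal (|u x| ^ p) /
                ENNReal.ofReal (infDist x (truncSet E z r) ^ (s * p)) ∂μ) ≤
            ENNReal.ofReal C *
              ∫⁻ x in ball z (8 * r), ∫⁻ y in ball z (8 * r), fracKernel μ s p u x y ∂μ ∂μ := by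
  have hsf : SigmaFinite μ := sigmaFinite_of_ball_lt_top fun x ρ hρ => (hball x ρ hρ).2
  have hsc : SecondCountableTopology X :=
    secondCountable_of_ball_pos (μ := μ) fun x ρ hρ => (hball x ρ hρ).1
  set c := ENNReal.ofReal c_μ with hcdef
  have hct : c ≠ ⊤ := ENNReal.ofReal_ne_top
  have hp : 1 ≤ p := by linarith
  have hp0 : 0 < p := by linarith
  have hα : 0 < s * q := by positivity
  have hαp : s * q < s * p := by gcongr
  set A : ℝ≥0∞ := c ^ 2 * (1 - ENNReal.ofReal (2 ^ (-(s * p - s * q))))⁻¹ *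
    ENNReal.ofReal (5 ^ (s * p - s * q)) with hA
  have hAt : A ≠ ⊤ := by
    have h1 : (2 : ℝ) ^ (-(s * p - s * q)) < 1 :=
      Real.rpow_lt_one_of_one_lt_of_neg one_lt_two (by linarith)
    refine ENNReal.mul_ne_top (ENNReal.mul_ne_top (ENNReal.pow_ne_top hct)
      (ENNReal.inv_ne_top.2 ?_)) ENNReal.ofReal_ne_top
    exact (tsub_pos_of_lt (ENNReal.ofReal_lt_one.2 h1)).ne'
  have h2t : (2 : ℝ≥0∞) ^ (p - 1) ≠ ⊤ :=
    ENNReal.rpow_ne_top_of_nonneg (by linarith) (by simp)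
  set T : ℝ≥0∞ := 2 ^ (p - 1) * c ^ 9 * A with hT
  have hTt : T ≠ ⊤ :=
    ENNReal.mul_ne_top (ENNReal.mul_ne_top h2t (ENNReal.pow_ne_top hct)) hAt
  set ε : ℝ := (2 * (T.toReal + 1))⁻¹ with hε
  have hT0 : 0 ≤ T.toReal := ENNReal.toReal_nonneg
  have hε0 : 0 < ε := by positivity
  have hεT : T * ENNReal.ofReal ε ≤ 2⁻¹ := by
    rw [← ENNReal.ofReal_toReal hTt, ← ENNReal.ofReal_mul hT0]
    have h2 : (2⁻¹ : ℝ≥0∞) = ENNReal.ofReal 2⁻¹ := by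
      rw [ENNReal.ofReal_inv_of_pos two_pos]
      simp
    rw [h2]
    refine ENNReal.ofReal_le_ofReal ?_
    rw [hε, mul_inv_le_iff₀ (by positivity)]
    linarith
  obtain ⟨δ, hδ, haik⟩ := haik ε hε0
  set M : ℝ≥0∞ := 2 ^ (p - 1) * c ^ 9 * ENNReal.ofReal δ⁻¹ * ENNReal.ofReal (4 ^ (s * p)) with hM
  have hMt : 2 * M ≠ ⊤ := ENNReal.mul_ne_top (by simp) (ENNReal.mul_ne_top (ENNReal.mul_ne_top
    (ENNReal.mul_ne_top h2t (ENNReal.pow_ne_top hct)) ENNReal.ofReal_ne_top)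
    ENNReal.ofReal_ne_top)
  refine ⟨(2 * M).toReal + 1, by positivity, fun z hz r hr hrE u ⟨L, hL⟩ huF => ?_⟩
  set F := truncSet E z r with hF
  set Ω := ball z (8 * r) with hΩ
  have hFc : IsClosed F := isClosed_closure
  have hFne : F.Nonempty := ⟨z, center_mem_truncSet hz hr⟩
  have hum : Measurable u := hL.continuous.measurable
  have hDm : Measurable fun x => infDist x F := (continuous_infDist_pt F).measurable
  have hDr : ∀ x ∈ Ω, infDist x F ≤ 8 * r := fun x hx =>
    (infDist_le_dist_of_mem (center_mem_truncSet hz hr)).trans (mem_ball.1 hx).le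
  set H := ∫⁻ x in Ω \ F, ENNReal.ofReal (|u x| ^ p) / ENNReal.ofReal (infDist x F ^ (s * p)) ∂μ
  have hHt : H ≠ ⊤ := (lintegral_hardy_lt_top hp hs1 hFc hFne hL huF measurableSet_ball
    (hball z _ (by positivity)).2.ne hDr).ne
  set G : X × X → ℝ≥0∞ := {q : X × X | dist q.1 q.2 < 4 * infDist q.1 F}.indicator
    (fun x => ENNReal.ofReal (infDist x.1 F ^ (-(s * p - s * q))) *
      (μ (ball x.1 (4 * infDist x.1 F)))⁻¹) with hG
  have hpt : ∀ x ∈ Ω \ F,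
      ENNReal.ofReal (|u x| ^ p) / ENNReal.ofReal (infDist x F ^ (s * p)) ≤
      2 ^ (p - 1) * c ^ 9 * ENNReal.ofReal ε * ∫⁻ y in Ω, G (x, y) *
        (ENNReal.ofReal (|u y| ^ p) * ENNReal.ofReal (infDist y F ^ (-(s * q)))) ∂μ +
      M * ∫⁻ y in Ω, fracKernel μ s p u x y ∂μ := by
    intro x hx
    have hDx : 0 < infDist x F := (hFc.notMem_iff_infDist_pos hFne).1 hx.2
    obtain ⟨e, he, hxe, hsub, heq⟩ := exists_ball_infDist_eq hE hz hr hx.1 hDx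
    refine ofReal_abs_rpow_div_le hball hdoubling hp hs0 hα hε0 hδ hDm
      (fun _ => infDist_nonneg) hum
      (fun y hy => huF y ((hFc.mem_iff_infDist_zero hFne).2 hy)) hDx hxe hsub ?_
    intro K hK hle
    refine (haik e he _ (by positivity) (lt_of_le_of_lt (ENNReal.ofReal_le_ofReal ?_) hrE) K hK
      hle).trans_eq ?_
    · linarith [hDr x hx.1]
    · congr 1
      exact setLIntegral_congr_fun (measurableSet_ball.inter hK) fun y hy => by
        simp only [heq y hy.1, hF]
  have hfin : H ≤ 2⁻¹ * H + M * ∫⁻ x in Ω, ∫⁻ y in Ω, fracKernel μ s p u x y ∂μ ∂μ := by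
    have hGm : Measurable G := measurable_indicator_rpow_div_measure_ball hDm _
    have hwm : Measurable fun y =>
        ENNReal.ofReal (|u y| ^ p) * ENNReal.ofReal (infDist y F ^ (-(s * q))) := by fun_prop
    have hgm : Measurable fun x => ∫⁻ y in Ω, G (x, y) *
        (ENNReal.ofReal (|u y| ^ p) * ENNReal.ofReal (infDist y F ^ (-(s * q)))) ∂μ :=
      (hGm.mul (hwm.comp measurable_snd)).lintegral_prod_right'
    have hMt' : M ≠ ⊤ := fun h => hMt (by rw [h]; simp)
    calc H ≤ ∫⁻ x in Ω \ F, (2 ^ (p - 1) * c ^ 9 * ENNReal.ofReal ε * ∫⁻ y in Ω, G (x, y) *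
          (ENNReal.ofReal (|u y| ^ p) * ENNReal.ofReal (infDist y F ^ (-(s * q)))) ∂μ +
          M * ∫⁻ y in Ω, fracKernel μ s p u x y ∂μ) ∂μ :=
          setLIntegral_mono' (measurableSet_ball.diff hFc.measurableSet) hpt
      _ = 2 ^ (p - 1) * c ^ 9 * ENNReal.ofReal ε * ∫⁻ x in Ω \ F, ∫⁻ y in Ω, G (x, y) *
          (ENNReal.ofReal (|u y| ^ p) * ENNReal.ofReal (infDist y F ^ (-(s * q)))) ∂μ ∂μ +
          M * ∫⁻ x in Ω \ F, ∫⁻ y in Ω, fracKernel μ s p u x y ∂μ ∂μ := by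
          rw [lintegral_add_left (hgm.const_mul _), lintegral_const_mul _ hgm,
            lintegral_const_mul' _ _ hMt']
      _ ≤ 2 ^ (p - 1) * c ^ 9 * ENNReal.ofReal ε * (A * H) +
          M * ∫⁻ x in Ω, ∫⁻ y in Ω, fracKernel μ s p u x y ∂μ ∂μ := by
          refine add_le_add (mul_le_mul_right ?_ _)
            (mul_le_mul_right (lintegral_mono_set sdiff_subset) _)
          exact lintegral_lintegral_indicator_mul_le hball hdoubling hp0 hαp hFc hFne hum huF Ω
            (Ω \ F) measurableSet_ball
      _ = T * ENNReal.ofReal ε * H +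
          M * ∫⁻ x in Ω, ∫⁻ y in Ω, fracKernel μ s p u x y ∂μ ∂μ := by
          rw [hT]
          ring
      _ ≤ _ := by gcongr
  refine (ENNReal.le_two_mul_of_le_half_mul_add hHt hfin).trans ?_
  rw [← mul_assoc]
  gcongr
  calc 2 * M = ENNReal.ofReal (2 * M).toReal := (ENNReal.ofReal_toReal hMt).symm
    _ ≤ _ := ENNReal.ofReal_le_ofReal (by linarith)
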